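/- Let κ = (κ₀,κ₁,κ₂,κ₃,κ₄) ∈ ℂ⁵ with 2κ₀+κ₁+κ₂+κ₃+κ₄ = 1, let n > 1 be an integer, let m be an integer with 0 < m < n and gcd(m,n) = 1, and let t ∈ ℂ∖{0}. Then there exist r ∈ (0,1) and functions Q, P₀ : ℂ → ℂ, both analytic on {w : |w| < r}, such that, setting P(w) = w^{−m}·P₀(w): (i) Q vanishes to order exactly m at w = 0 and its m-th Taylor coefficient at 0 equals t (i.e. Q(w) = t·wᵐ + O(w^{m+1})); (ii) P₀(0) = (m + n(κ₁+κ₂−1))/(2nt); (iii) for every w with 0 < |w| < r, wⁿ(wⁿ−1)·Q′(w) = n·wⁿ⁻¹·(2Q(Q−1)(Q−wⁿ)P − κ₁(Q−1)(Q−wⁿ) − (κ₂−1)Q(Q−1) − κ₃Q(Q−wⁿ)) and wⁿ(wⁿ−1)·P′(w) = n·wⁿ⁻¹·(−(3Q²−2(1+wⁿ)Q+wⁿ)P² + (κ₁(2Q−1−wⁿ)+(κ₂−1)(2Q−1)+κ₃(2Q−wⁿ))P − κ₀(κ₀+κ₄)), where Q = Q(w), P = P(w). (This produces a 1-parameter family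 of algebraic n-branch solutions (q,p)(z) = (Q,P)(z^{1/n}) of P_VI(κ) around z = 0, with q(z) = t·z^{m/n} + higher order terms.) -/

import Mathlib

/-- The sixth Painlevé system `P_VI(κ)` pulled back along the covering `w ↦ z = wⁿ`:
the lifted pair `(Q, P)` satisfies the Hamiltonian system multiplied through by the
chain-rule factor `n·wⁿ⁻¹`. -/
def SolvesLiftedPVIAt (κ₀ κ₁ κ₂ κ₃ κ₄ : ℂ) (n : ℕ) (Q P : ℂ → ℂ) (w : ℂ) : Prop :=
  w ^ n * (w ^ n - 1) * deriv Q w =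
      (n : ℂ) * w ^ (n - 1) *
        (2 * Q w * (Q w - 1) * (Q w - w ^ n) * P w - κ₁ * (Q w - 1) * (Q w - w ^ n)
          - (κ₂ - 1) * Q w * (Q w - 1) - κ₃ * Q w * (Q w - w ^ n)) ∧
  w ^ n * (w ^ n - 1) * deriv P w =
      (n : ℂ) * w ^ (n - 1) *
        (-(3 * Q w ^ 2 - 2 * (1 + w ^ n) * Q w + w ^ n) * P w ^ 2
          + (κ₁ * (2 * Q w - 1 - w ^ n) + (κ₂ - 1) * (2 * Q w - 1)
              + κ₃ * (2 * Q w - w ^ n)) * P w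
          - κ₀ * (κ₀ + κ₄))

section

open Filter Topology Polynomial

/-- If `Ψ (0, ·)` is constant, then `Ψ (ε, ·)` has a fixed point for all small `ε`. -/
theorem eventually_exists_fixed_point_of_contDiff {E : Type*} [NormedAddCommGroup E]
    [NormedSpace ℂ E] [CompleteSpace E] {Ψ : ℂ × E → E} (hΨ : ContDiff ℂ 1 Ψ) {y₀ : E}
    (h₀ : ∀ y, Ψ (0, y) = y₀) : ∀ᶠ ε in 𝓝 (0 : ℂ), ∃ y, Ψ (ε, y) = y := by
  set F : ℂ × E → ℂ × E := fun p => (p.1, p.2 - Ψ p) with hF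
  set D := fderiv ℂ Ψ (0, y₀) with hD
  have hΨd : HasStrictFDerivAt Ψ D (0, y₀) :=
    hΨ.contDiffAt.hasStrictFDerivAt one_ne_zero
  have hFd : HasStrictFDerivAt F ((ContinuousLinearMap.fst ℂ ℂ E).prod
      (ContinuousLinearMap.snd ℂ ℂ E - D)) (0, y₀) :=
    hasStrictFDerivAt_fst.prodMk (hasStrictFDerivAt_snd.sub hΨd)
  have hD0 : ∀ b : E, D (0, b) = 0 := by
    intro b
    have h1 : HasFDerivAt (fun y : E => Ψ (0, y)) (D.comp (ContinuousLinearMap.inr ℂ ℂ E)) y₀ :=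
      HasFDerivAt.comp (g := Ψ) y₀ hΨd.hasFDerivAt (hasFDerivAt_prodMk_right (0 : ℂ) y₀)
    have h2 : HasFDerivAt (fun y : E => Ψ (0, y)) (0 : E →L[ℂ] E) y₀ := by
      simp only [h₀]; exact hasFDerivAt_const _ _
    simpa using congrArg (fun L : E →L[ℂ] E => L b) (h1.unique h2)
  have hmap := hFd.map_nhds_eq_of_surj (by
    rw [LinearMap.range_eq_top]
    rintro ⟨a, b⟩
    refine ⟨(a, b + D (a, 0)), ?_⟩
    have : D (a, b + D (a, 0)) = D (a, 0) + D (0, b + D (a, 0)) := by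
      rw [← map_add]; simp
    simp [this, hD0])
  have hF0 : F (0, y₀) = (0, 0) := by simp [hF, h₀]
  have himg : Set.range F ∈ 𝓝 ((0 : ℂ), (0 : E)) := by
    rw [← hF0, ← hmap]; exact Filter.range_mem_map
  have hc : Tendsto (fun ε : ℂ => (ε, (0 : E))) (𝓝 0) (𝓝 ((0 : ℂ), (0 : E))) :=
    (Continuous.prodMk_left (0 : E)).tendsto 0
  filter_upwards [hc himg] with ε hε
  obtain ⟨⟨a, y⟩, hy⟩ := hε
  simp only [hF, Prod.mk.injEq] at hy
  obtain ⟨rfl, hy⟩ := hy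
  exact ⟨y, (sub_eq_zero.1 hy).symm⟩

abbrev closedUnitDisc : Set ℂ := Metric.closedBall 0 1

/-- The radial contraction `x ↦ s x` of the closed unit disc, with `s` clamped to `[0, 1]`. -/
noncomputable def discContract (s : ℝ) (x : closedUnitDisc) : closedUnitDisc :=
  ⟨((Set.projIcc (0 : ℝ) 1 zero_le_one s : ℝ) : ℂ) * x, by
    have h1 := (Set.projIcc (0 : ℝ) 1 zero_le_one s).2
    have h2 := x.2
    simp only [mem_closedBall_zero_iff, norm_mul, Complex.norm_real, Real.norm_eq_abs] at h2 ⊢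
    rw [abs_of_nonneg h1.1]
    exact mul_le_one₀ h1.2 (norm_nonneg _) h2⟩

theorem continuous_discContract : Continuous fun p : closedUnitDisc × ℝ => discContract p.2 p.1 := by
  unfold discContract
  have : Continuous (Set.projIcc (0 : ℝ) 1 zero_le_one) := continuous_projIcc
  fun_prop

theorem coe_discContract {s : ℝ} (hs : s ∈ Set.Icc (0 : ℝ) 1) (x : closedUnitDisc) :
    (discContract s x : ℂ) = s * x := by
  simp [discContract, Set.projIcc_of_mem _ hs]

/-- The radial average `f ↦ ∫₀¹ f(s x) ds`, i.e. the inverse of `x d/dx + 1`. -/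
noncomputable def radialAverage : C(closedUnitDisc, ℂ) →L[ℂ] C(closedUnitDisc, ℂ) :=
  have hc (f : C(closedUnitDisc, ℂ)) :
      Continuous fun p : closedUnitDisc × ℝ => f (discContract p.2 p.1) :=
    f.continuous.comp continuous_discContract
  have hi (f : C(closedUnitDisc, ℂ)) (x : closedUnitDisc) :
      IntervalIntegrable (fun s => f (discContract s x)) MeasureTheory.volume 0 1 :=
    ((hc f).comp (Continuous.prodMk_right x)).intervalIntegrable _ _
  LinearMap.mkContinuous
    { toFun := fun f => ⟨fun x => ∫ s in (0 : ℝ)..1, f (discContract s x),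
        intervalIntegral.continuous_parametric_intervalIntegral_of_continuous' (hc f) 0 1⟩
      map_add' := fun f g => by
        ext x
        exact intervalIntegral.integral_add (hi f x) (hi g x)
      map_smul' := fun c f => by
        ext x
        exact intervalIntegral.integral_smul c _ } 1 (fun f => by
    rw [one_mul, ContinuousMap.norm_le _ (norm_nonneg _)]
    intro x
    simpa using intervalIntegral.norm_integral_le_of_norm_le_const (a := (0 : ℝ)) (b := 1)
      (C := ‖f‖) (f := fun s => f (discContract s x)) (fun s _ => f.norm_coe_le_norm _))

theorem radialAverage_apply (f : C(closedUnitDisc, ℂ)) (x : closedUnitDisc) :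
    radialAverage f x = ∫ s in (0 : ℝ)..1, f (discContract s x) := rfl

theorem exists_radialAverage_polynomial (p : ℂ[X]) :
    ∃ q : ℂ[X], radialAverage (p.toContinuousMapOn closedUnitDisc) =
      q.toContinuousMapOn closedUnitDisc ∧ derivative (X * q) = p := by
  induction p using Polynomial.induction_on' with
  | add p₁ p₂ h₁ h₂ =>
    obtain ⟨q₁, h₁, d₁⟩ := h₁
    obtain ⟨q₂, h₂, d₂⟩ := h₂
    refine ⟨q₁ + q₂, ?_, by rw [mul_add, derivative_add, d₁, d₂]⟩
    have h (a b : ℂ[X]) : (a + b).toContinuousMapOn closedUnitDisc =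
      a.toContinuousMapOn closedUnitDisc + b.toContinuousMapOn closedUnitDisc :=
      map_add (toContinuousMapOnAlgHom closedUnitDisc) a b
    rw [h, h, map_add, h₁, h₂]
  | monomial k c =>
    have hk : (k : ℂ) + 1 ≠ 0 := Nat.cast_add_one_ne_zero k
    refine ⟨monomial k (c / (k + 1)), ?_, ?_⟩
    · ext x
      rw [radialAverage_apply]
      have : ∀ s ∈ Set.uIcc (0 : ℝ) 1,
          (monomial k c).toContinuousMapOn closedUnitDisc (discContract s x) =
            ((s ^ k : ℝ) : ℂ) * (c * (x : ℂ) ^ k) := by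
        intro s hs
        rw [Set.uIcc_of_le zero_le_one] at hs
        simp [coe_discContract hs, mul_pow]
        ring
      rw [intervalIntegral.integral_congr this, intervalIntegral.integral_mul_const,
        intervalIntegral.integral_ofReal, integral_pow]
      simp
      field_simp
    · rw [X_mul_monomial, derivative_monomial]
      simp [hk]

/-- The disc algebra: uniform limits of polynomials on the closed unit disc. -/
noncomputable abbrev discAlgebra : Subalgebra ℂ C(closedUnitDisc, ℂ) :=
  (polynomialFunctions closedUnitDisc).topologicalClosure

instance : CompleteSpace discAlgebra :=
  (Subalgebra.isClosed_topologicalClosure _).completeSpace_coe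

theorem radialAverage_mem_discAlgebra {f : C(closedUnitDisc, ℂ)} (hf : f ∈ discAlgebra) :
    radialAverage f ∈ discAlgebra := by
  refine map_mem_closure radialAverage.continuous hf ?_
  intro g hg
  change g ∈ (polynomialFunctions closedUnitDisc : Set C(closedUnitDisc, ℂ)) at hg
  change _ ∈ (polynomialFunctions closedUnitDisc : Set C(closedUnitDisc, ℂ))
  rw [polynomialFunctions_coe] at hg ⊢
  obtain ⟨p, rfl⟩ := hg
  obtain ⟨q, hq, -⟩ := exists_radialAverage_polynomial p
  exact ⟨q, hq.symm⟩

/-- The radial average as an operator on the disc algebra. -/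
noncomputable def discAverage : discAlgebra →L[ℂ] discAlgebra :=
  (radialAverage.comp discAlgebra.toSubmodule.subtypeL).codRestrict discAlgebra.toSubmodule
    fun f => radialAverage_mem_discAlgebra f.2

open Classical in
/-- Extension by zero from the closed unit disc to the plane. -/
noncomputable def discExtend (f : C(closedUnitDisc, ℂ)) (x : ℂ) : ℂ :=
  if h : x ∈ closedUnitDisc then f ⟨x, h⟩ else 0

theorem discExtend_of_mem (f : C(closedUnitDisc, ℂ)) {x : ℂ} (h : x ∈ closedUnitDisc) :
    discExtend f x = f ⟨x, h⟩ := dif_pos h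

theorem hasDerivAt_mul_radialAverage {f : C(closedUnitDisc, ℂ)} (hf : f ∈ discAlgebra) {x : ℂ}
    (hx : x ∈ Metric.ball (0 : ℂ) 1) :
    HasDerivAt (fun y => y * discExtend (radialAverage f) y) (discExtend f x) x := by
  have hne : NeBot (𝓝 f ⊓ 𝓟 (polynomialFunctions closedUnitDisc : Set C(closedUnitDisc, ℂ))) :=
    mem_closure_iff_clusterPt.1 hf
  refine hasDerivAt_of_tendstoUniformlyOn (l := 𝓝 f ⊓ 𝓟 (polynomialFunctions closedUnitDisc :
    Set C(closedUnitDisc, ℂ))) (f := fun g y => y * discExtend (radialAverage g) y)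
    (f' := discExtend) (s := Metric.ball 0 1) Metric.isOpen_ball ?_ ?_ ?_ hx
  · rw [Metric.tendstoUniformlyOn_iff]
    intro ε hε
    filter_upwards [mem_inf_of_left (Metric.ball_mem_nhds f hε)] with g hg y hy
    have hy' := Metric.ball_subset_closedBall hy
    rw [discExtend_of_mem _ hy', discExtend_of_mem _ hy']
    exact (ContinuousMap.dist_apply_le_dist _).trans_lt (by rwa [dist_comm])
  · filter_upwards [mem_inf_of_right (mem_principal_self _)] with g hg y hy
    rw [polynomialFunctions_coe] at hg
    obtain ⟨p, rfl⟩ := hg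
    obtain ⟨q, hq, hd⟩ := exists_radialAverage_polynomial p
    have h := (X * q).hasDerivAt y
    rw [hd] at h
    rw [discExtend_of_mem _ (Metric.ball_subset_closedBall hy)]
    refine h.congr_of_eventuallyEq ?_
    filter_upwards [Metric.isOpen_ball.mem_nhds hy] with z hz
    have hz' := Metric.ball_subset_closedBall hz
    rw [discExtend_of_mem _ hz']
    change z * radialAverage (p.toContinuousMapOn closedUnitDisc) ⟨z, hz'⟩ = _
    rw [hq]
    simp
  · intro y hy
    have hy' := Metric.ball_subset_closedBall hy
    simp only [discExtend_of_mem _ hy']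
    refine Tendsto.mono_left ?_ inf_le_left
    have : Continuous fun g : C(closedUnitDisc, ℂ) => y * radialAverage g ⟨y, hy'⟩ :=
      continuous_const.mul ((continuous_eval_const _).comp radialAverage.continuous)
    exact this.tendsto f

/-- The `U`-component of the reduced system: see `lifted_equations_of_drift`. -/
def driftU {R : Type*} [CommRing R] (n m k₁ k₂ k₃ t d a b W u p h : R) : R :=
  2 * n * W * (t * u * p + u * (u * d + t * p + W * u * p))
    - n * (2 * (t + W * u) * (d + W * p) * (a * (t + W * u) * (t + W * u - W * b) + b)
      - k₁ * (a * (t + W * u) * (t + W * u - W * b) + b) - (k₂ - 1) * a * (t + W * u) ^ 2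
      - k₃ * a * (t + W * u) * (t + W * u - W * b))
    + W * a * b * m * (t + W * u) + W ^ 2 * a * b * (2 * n * (t * d * u + t ^ 2 * p) + h)

/-- The `P`-component of the reduced system: see `lifted_equations_of_drift`. -/
def driftP {R : Type*} [CommRing R] (n m k₁ k₂ k₃ l t d a b W u p h : R) : R :=
  -(2 * n * W * (d * u * p + p * (u * d + t * p + W * u * p)))
    - n * (-(3 * a * (t + W * u) ^ 2 - 2 * W * a * b * (t + W * u) + b) * (d + W * p) ^ 2
      + (k₁ * (2 * a * (t + W * u) - W * a * b) + (k₂ - 1) * (2 * a * (t + W * u))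
        + k₃ * (2 * a * (t + W * u) - W * a * b)) * (d + W * p) - a * l)
    - W * a * b * m * (d + W * p) - W ^ 2 * a * b * (2 * n * (d ^ 2 * u + t * d * p) - h)

theorem lifted_equations_of_drift {n m k₁ k₂ k₃ l t d a b w u p h₁ h₂ U P₀ P U' P' : ℂ}
    (hd : 2 * n * t * d = m + n * (k₁ + k₂ - 1)) (hw : w ≠ 0) (ha : a ≠ 0)
    (hU : U = t + w * u) (hP₀ : P₀ = d + w * p) (hP : P = P₀ / (w * a))
    (h1 : h₁ = driftU n m k₁ k₂ k₃ t d a b w u p h₁)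
    (h2 : h₂ = driftP n m k₁ k₂ k₃ l t d a b w u p h₂)
    (hU' : U' = h₁ + 2 * n * (t * d * u + t ^ 2 * p))
    (hP' : P' = h₂ - 2 * n * (d ^ 2 * u + t * d * p)) :
    (w ^ 2 * a * b) * (w ^ 2 * a * b - 1) * (m * a * U + w * a * U') =
      n * (w * a * b) * (2 * (w * a * U) * (w * a * U - 1) * (w * a * U - w ^ 2 * a * b) * P
        - k₁ * (w * a * U - 1) * (w * a * U - w ^ 2 * a * b)
        - (k₂ - 1) * (w * a * U) * (w * a * U - 1)
        - k₃ * (w * a * U) * (w * a * U - w ^ 2 * a * b)) ∧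
    (w ^ 2 * a * b) * (w ^ 2 * a * b - 1) * ((P' * (w * a) - P₀ * (m * a)) / (w * a) ^ 2) =
      n * (w * a * b) * (-(3 * (w * a * U) ^ 2 - 2 * (1 + w ^ 2 * a * b) * (w * a * U)
          + w ^ 2 * a * b) * P ^ 2
        + (k₁ * (2 * (w * a * U) - 1 - w ^ 2 * a * b) + (k₂ - 1) * (2 * (w * a * U) - 1)
          + k₃ * (2 * (w * a * U) - w ^ 2 * a * b)) * P - l) := by
  have e1 : (1 - w ^ 2 * a * b) * (w * U') = -((1 - w ^ 2 * a * b) * (m * U))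
      - n * (2 * U * (w * a * U - 1) * (U - w * b) * P₀ - k₁ * (w * a * U - 1) * (U - w * b)
        - (k₂ - 1) * U * (w * a * U - 1) - k₃ * (w * a * U) * (U - w * b)) := by
    subst hU hP₀ hU'
    unfold driftU at h1
    linear_combination w * h1 - (t + w * u) * hd
  have e2 : (1 - w ^ 2 * a * b) * (w * P') = (1 - w ^ 2 * a * b) * (m * P₀)
      - n * (-(3 * (w * a * U ^ 2) - 2 * (1 + w ^ 2 * a * b) * U + w * b) * P₀ ^ 2
        + (k₁ * (2 * (w * a * U) - 1 - w ^ 2 * a * b) + (k₂ - 1) * (2 * (w * a * U) - 1)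
          + k₃ * (2 * (w * a * U) - w ^ 2 * a * b)) * P₀ - w * a * l) := by
    subst hU hP₀ hP'
    unfold driftP at h2
    linear_combination w * h2 + (d + w * p) * hd
  have hP : P₀ = w * a * P := by rw [hP]; field_simp
  constructor
  · rw [hP] at e1
    linear_combination (-(w ^ 2 * a ^ 2 * b)) * e1
  · have hq : (w ^ 2 * a * b) * (w ^ 2 * a * b - 1) * ((P' * (w * a) - P₀ * (m * a)) / (w * a) ^ 2)
        = b * (w ^ 2 * a * b - 1) * (w * P' - P₀ * m) := by
      field_simp
    rw [hq]
    rw [hP] at e2 ⊢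
    linear_combination (-b) * e2

theorem map_driftU {R S : Type*} [CommRing R] [CommRing S] (φ : R →+* S)
    (n m k₁ k₂ k₃ t d a b W u p h : R) :
    φ (driftU n m k₁ k₂ k₃ t d a b W u p h) = driftU (φ n) (φ m) (φ k₁) (φ k₂) (φ k₃) (φ t) (φ d)
      (φ a) (φ b) (φ W) (φ u) (φ p) (φ h) := by
  simp [driftU, map_ofNat φ 2]

theorem map_driftP {R S : Type*} [CommRing R] [CommRing S] (φ : R →+* S)
    (n m k₁ k₂ k₃ l t d a b W u p h : R) :
    φ (driftP n m k₁ k₂ k₃ l t d a b W u p h) = driftP (φ n) (φ m) (φ k₁) (φ k₂) (φ k₃) (φ l)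
      (φ t) (φ d) (φ a) (φ b) (φ W) (φ u) (φ p) (φ h) := by
  simp [driftP, map_ofNat φ 2, map_ofNat φ 3]

theorem ContDiff.driftU {E A : Type*} [NormedAddCommGroup E] [NormedSpace ℂ E]
    [NormedCommRing A] [NormedAlgebra ℂ A] {a b W u p h : E → A} (n m k₁ k₂ k₃ t d : A)
    (ha : ContDiff ℂ 1 a) (hb : ContDiff ℂ 1 b) (hW : ContDiff ℂ 1 W) (hu : ContDiff ℂ 1 u)
    (hp : ContDiff ℂ 1 p) (hh : ContDiff ℂ 1 h) :
    ContDiff ℂ 1 fun x => _root_.driftU n m k₁ k₂ k₃ t d (a x) (b x) (W x) (u x) (p x) (h x) := by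
  unfold _root_.driftU
  fun_prop

theorem ContDiff.driftP {E A : Type*} [NormedAddCommGroup E] [NormedSpace ℂ E]
    [NormedCommRing A] [NormedAlgebra ℂ A] {a b W u p h : E → A} (n m k₁ k₂ k₃ l t d : A)
    (ha : ContDiff ℂ 1 a) (hb : ContDiff ℂ 1 b) (hW : ContDiff ℂ 1 W) (hu : ContDiff ℂ 1 u)
    (hp : ContDiff ℂ 1 p) (hh : ContDiff ℂ 1 h) :
    ContDiff ℂ 1 fun x => _root_.driftP n m k₁ k₂ k₃ l t d (a x) (b x) (W x) (u x) (p x) (h x) := by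
  unfold _root_.driftP
  fun_prop

/-- The coordinate function. -/
noncomputable def discId : discAlgebra :=
  ⟨X.toContinuousMapOn closedUnitDisc, subset_closure (by
    change _ ∈ (polynomialFunctions closedUnitDisc : Set C(closedUnitDisc, ℂ))
    rw [polynomialFunctions_coe]
    exact ⟨X, rfl⟩)⟩

/-- Evaluation at a point of the closed unit disc. -/
noncomputable def discEval (x : closedUnitDisc) : discAlgebra →ₐ[ℂ] ℂ :=
  (ContinuousMap.evalAlgHom ℂ ℂ x).comp discAlgebra.val

theorem discEval_apply (x : closedUnitDisc) (f : discAlgebra) :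
    discEval x f = (f : C(closedUnitDisc, ℂ)) x := rfl

theorem discEval_discId (x : closedUnitDisc) : discEval x discId = x := by
  simp [discEval_apply, discId]

theorem hasDerivAt_mul_discAverage (f : discAlgebra) {x : ℂ} (hx : x ∈ Metric.ball (0 : ℂ) 1) :
    HasDerivAt (fun y => y * discExtend (discAverage f : discAlgebra) y) (discExtend f x) x :=
  hasDerivAt_mul_radialAverage f.2 hx

theorem exists_drift_fixed_point (n m k₁ k₂ k₃ l t d : ℂ) (i j : ℕ) :
    ∃ (ε : ℂ) (u p h₁ h₂ : discAlgebra), ε ≠ 0 ∧ ‖ε‖ < 1 ∧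
      u = discAverage (h₁ + (2 * n) • ((t * d) • u + t ^ 2 • p)) ∧
      p = discAverage (h₂ - (2 * n) • (d ^ 2 • u + (t * d) • p)) ∧
      ∀ x : closedUnitDisc,
        discEval x h₁ = driftU n m k₁ k₂ k₃ t d ((ε * x) ^ i) ((ε * x) ^ j) (ε * x)
          (discEval x u) (discEval x p) (discEval x h₁) ∧
        discEval x h₂ = driftP n m k₁ k₂ k₃ l t d ((ε * x) ^ i) ((ε * x) ^ j) (ε * x)
          (discEval x u) (discEval x p) (discEval x h₂) := by
  let J := discAverage
  let c : ℂ → discAlgebra := algebraMap ℂ discAlgebra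
  let u : discAlgebra × discAlgebra → discAlgebra := fun y =>
    J (y.1 + (2 * n) • ((t * d) • J y.1 + t ^ 2 • J y.2))
  let p : discAlgebra × discAlgebra → discAlgebra := fun y =>
    J (y.2 - (2 * n) • (d ^ 2 • J y.1 + (t * d) • J y.2))
  have hu : ContDiff ℂ 1 u := by fun_prop
  have hp : ContDiff ℂ 1 p := by fun_prop
  let Ψ : ℂ × (discAlgebra × discAlgebra) → discAlgebra × discAlgebra := fun q =>
    (driftU (c n) (c m) (c k₁) (c k₂) (c k₃) (c t) (c d) ((q.1 • discId) ^ i)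
      ((q.1 • discId) ^ j) (q.1 • discId) (u q.2) (p q.2) q.2.1,
     driftP (c n) (c m) (c k₁) (c k₂) (c k₃) (c l) (c t) (c d) ((q.1 • discId) ^ i)
      ((q.1 • discId) ^ j) (q.1 • discId) (u q.2) (p q.2) q.2.2)
  have hΨ : ContDiff ℂ 1 Ψ := by
    have hu' : ContDiff ℂ 1 fun q : ℂ × (discAlgebra × discAlgebra) => u q.2 :=
      hu.comp contDiff_snd
    have hp' : ContDiff ℂ 1 fun q : ℂ × (discAlgebra × discAlgebra) => p q.2 :=
      hp.comp contDiff_snd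
    have hW : ContDiff ℂ 1 fun q : ℂ × (discAlgebra × discAlgebra) => q.1 • discId := by fun_prop
    exact (ContDiff.driftU _ _ _ _ _ _ _ (hW.pow i) (hW.pow j) hW hu' hp' (by fun_prop)).prodMk
      (ContDiff.driftP _ _ _ _ _ _ _ _ (hW.pow i) (hW.pow j) hW hu' hp' (by fun_prop))
  have h₀ : ∀ y, Ψ (0, y) = Ψ (0, 0) := by
    intro y
    simp [Ψ, driftU, driftP]
  have hev := eventually_exists_fixed_point_of_contDiff hΨ h₀
  have hsmall : ∀ᶠ ε in 𝓝 (0 : ℂ), ‖ε‖ < 1 := by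
    filter_upwards [Metric.ball_mem_nhds (0 : ℂ) one_pos] with ε hε
    exact mem_ball_zero_iff.1 hε
  obtain ⟨ε, ⟨⟨y, hy⟩, hε1⟩, hε0⟩ := (((hev.and hsmall).filter_mono nhdsWithin_le_nhds).and
    (self_mem_nhdsWithin : {(0 : ℂ)}ᶜ ∈ 𝓝[≠] (0 : ℂ))).exists
  have huv : u y = J y.1 + (2 * n) • ((t * d) • J (J y.1) + t ^ 2 • J (J y.2)) := by
    simp only [u, map_add, map_smul]
  have hpv : p y = J y.2 - (2 * n) • (d ^ 2 • J (J y.1) + (t * d) • J (J y.2)) := by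
    simp only [p, map_add, map_sub, map_smul]
  let φ (x : closedUnitDisc) : discAlgebra →+* ℂ := discEval x
  have hc (x : closedUnitDisc) (r : ℂ) : φ x (c r) = r := (discEval x).commutes r
  have hW (x : closedUnitDisc) : φ x (ε • discId) = ε * x :=
    (map_smul (discEval x) ε discId).trans (by rw [discEval_discId, smul_eq_mul])
  refine ⟨ε, u y, p y, y.1, y.2, hε0, hε1, ?_, ?_, fun x => ⟨?_, ?_⟩⟩
  · have : (t * d) • u y + t ^ 2 • p y = (t * d) • J y.1 + t ^ 2 • J y.2 := by
      rw [huv, hpv]; module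
    rw [this]
  · have : d ^ 2 • u y + (t * d) • p y = d ^ 2 • J y.1 + (t * d) • J y.2 := by
      rw [huv, hpv]; module
    rw [this]
  · have h : φ x (Ψ (ε, y)).1 = φ x y.1 := by rw [hy]
    simp only [Ψ] at h
    rw [map_driftU (φ x), map_pow, map_pow, hW] at h
    simp only [hc] at h
    exact h.symm
  · have h : φ x (Ψ (ε, y)).2 = φ x y.2 := by rw [hy]
    simp only [Ψ] at h
    rw [map_driftP (φ x), map_pow, map_pow, hW] at h
    simp only [hc] at h
    exact h.symm

/-- Rescaling `x ↦ w = ε x` turns a radial average into an honest primitive. -/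
theorem hasDerivAt_add_mul_discAverage (f : discAlgebra) (c : ℂ) {ε w : ℂ} (hε : ε ≠ 0)
    (hw : w / ε ∈ Metric.ball (0 : ℂ) 1) :
    HasDerivAt (fun v => c + v * discExtend (discAverage f : discAlgebra) (v / ε))
      (discExtend f (w / ε)) w := by
  have h := ((hasDerivAt_mul_discAverage f hw).comp w ((hasDerivAt_id w).div_const ε)).const_mul ε
  have h' := h.const_add c
  have e₁ (v : ℂ) : c + v * discExtend (discAverage f : discAlgebra) (v / ε) =
      c + ε * (v / ε * discExtend (discAverage f : discAlgebra) (v / ε)) := by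
    field_simp
  have e₂ : discExtend f (w / ε) = ε * (discExtend f (w / ε) * (1 / ε)) := by
    field_simp
  rw [funext e₁, e₂]
  exact h'

end

/-- For every `n > 1`, every `0 < m < n` coprime to `n` and every `t ≠ 0`, Painlevé VI
admits an algebraic `n`-branch solution around `z = 0` whose lift along `z = wⁿ` has
`Q(w) = t·wᵐ + O(w^{m+1})` and `P(w) = w^{−m}·P₀(w)` with
`P₀(0) = (m + n(κ₁+κ₂−1))/(2nt)`. -/
theorem algebraic_n_branch_solutions_exist
    (κ₀ κ₁ κ₂ κ₃ κ₄ : ℂ) (hκ : 2 * κ₀ + κ₁ + κ₂ + κ₃ + κ₄ = 1)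
    (n m : ℕ) (hn : 1 < n) (hm0 : 0 < m) (hmn : m < n) (hgcd : Nat.gcd m n = 1)
    (t : ℂ) (ht : t ≠ 0) :
    ∃ (r : ℝ) (Q P₀ : ℂ → ℂ), 0 < r ∧ r < 1 ∧
      (∀ w ∈ Metric.ball (0 : ℂ) r, AnalyticAt ℂ Q w) ∧
      (∀ w ∈ Metric.ball (0 : ℂ) r, AnalyticAt ℂ P₀ w) ∧
      (∃ h : ℂ → ℂ, (∀ w ∈ Metric.ball (0 : ℂ) r, AnalyticAt ℂ h w) ∧ h 0 = t ∧
        ∀ w ∈ Metric.ball (0 : ℂ) r, Q w = w ^ m * h w) ∧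
      P₀ 0 = ((m : ℂ) + (n : ℂ) * (κ₁ + κ₂ - 1)) / (2 * (n : ℂ) * t) ∧
      ∀ w ∈ Metric.ball (0 : ℂ) r, w ≠ 0 →
        SolvesLiftedPVIAt κ₀ κ₁ κ₂ κ₃ κ₄ n Q (fun u => P₀ u / u ^ m) w := by
  have hn0 : (n : ℂ) ≠ 0 := Nat.cast_ne_zero.2 (by omega)
  set d : ℂ := ((m : ℂ) + (n : ℂ) * (κ₁ + κ₂ - 1)) / (2 * (n : ℂ) * t) with hd
  have hd' : 2 * (n : ℂ) * t * d = m + n * (κ₁ + κ₂ - 1) := by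
    rw [hd]; field_simp
  obtain ⟨ε, u, p, h₁, h₂, hε0, hε1, hu, hp, hfix⟩ :=
    exists_drift_fixed_point n m κ₁ κ₂ κ₃ (κ₀ * (κ₀ + κ₄)) t d (m - 1) (n - m - 1)
  set f₁ := h₁ + (2 * (n : ℂ)) • ((t * d) • u + t ^ 2 • p) with hf₁
  set f₂ := h₂ - (2 * (n : ℂ)) • (d ^ 2 • u + (t * d) • p) with hf₂
  have hdisc : ∀ w ∈ Metric.ball (0 : ℂ) ‖ε‖, w / ε ∈ Metric.ball (0 : ℂ) 1 := by
    intro w hw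
    rw [mem_ball_zero_iff] at hw ⊢
    rw [norm_div]
    exact (div_lt_one (norm_pos_iff.2 hε0)).2 hw
  let U : ℂ → ℂ := fun w => t + w * discExtend u (w / ε)
  let P₀ : ℂ → ℂ := fun w => d + w * discExtend p (w / ε)
  have hU : ∀ w ∈ Metric.ball (0 : ℂ) ‖ε‖, HasDerivAt U (discExtend f₁ (w / ε)) w := by
    intro w hw
    have := hasDerivAt_add_mul_discAverage f₁ t hε0 (hdisc w hw)
    rwa [← hu] at this
  have hP₀ : ∀ w ∈ Metric.ball (0 : ℂ) ‖ε‖, HasDerivAt P₀ (discExtend f₂ (w / ε)) w := by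
    intro w hw
    have := hasDerivAt_add_mul_discAverage f₂ d hε0 (hdisc w hw)
    rwa [← hp] at this
  have analytic {F F' : ℂ → ℂ} (hF : ∀ w ∈ Metric.ball (0 : ℂ) ‖ε‖, HasDerivAt F (F' w) w) :
      ∀ w ∈ Metric.ball (0 : ℂ) ‖ε‖, AnalyticAt ℂ F w := fun w hw =>
    DifferentiableOn.analyticAt
      (fun v hv => (hF v hv).differentiableAt.differentiableWithinAt)
      (Metric.isOpen_ball.mem_nhds hw)
  refine ⟨‖ε‖, fun w => w ^ m * U w, P₀, norm_pos_iff.2 hε0, hε1,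
    fun w hw => (analyticAt_id.pow m).mul (analytic hU w hw), analytic hP₀,
    ⟨U, analytic hU, by simp [U], fun w _ => rfl⟩, by simp [P₀], ?_⟩
  intro w hw hw0
  have hx := Metric.ball_subset_closedBall (hdisc w hw)
  have hεx : ε * (w / ε) = w := by field_simp
  obtain ⟨e₁, e₂⟩ := hfix ⟨w / ε, hx⟩
  simp only [hεx, discEval_apply] at e₁ e₂
  have hQ' := ((hasDerivAt_pow m w).fun_mul (hU w hw)).deriv
  have hP' := ((hP₀ w hw).fun_div (hasDerivAt_pow m w) (pow_ne_zero m hw0)).deriv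
  have hwm : w ^ m = w * w ^ (m - 1) := by
    rw [← pow_succ']; congr 1; omega
  have hwn : w ^ n = w ^ 2 * w ^ (m - 1) * w ^ (n - m - 1) := by
    rw [← pow_add, ← pow_add]; congr 1; omega
  have hwn' : w ^ (n - 1) = w * w ^ (m - 1) * w ^ (n - m - 1) := by
    rw [← pow_succ', ← pow_add]; congr 1; omega
  have key := lifted_equations_of_drift (U := U w) (P₀ := P₀ w) hd' hw0 (pow_ne_zero (m - 1) hw0)
    (by simp only [U, discExtend_of_mem _ hx]) (by simp only [P₀, discExtend_of_mem _ hx]) rfl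
    e₁ e₂ rfl rfl
  unfold SolvesLiftedPVIAt
  rw [hQ', hP', discExtend_of_mem _ hx, discExtend_of_mem _ hx, hwn, hwn']
  beta_reduce
  rw [hwm]
  exact key
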